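/- arXiv:1908.02319 — 2 statements merged into one kernel-verified Lean document; each statement's English description precedes it below -/
import Mathlib

section
/- Let V be an n×n complex Hermitian positive semidefinite matrix, and let v̲, v̄ be real numbers with 0 < v̲ < v̄ such that v̲² ≤ V₁₁ ≤ v̄² (V₁₁ being the real (1,1) diagonal entry of V). Then there exists a vector v ∈ ℂⁿ such that V − v vᴴ is positive semidefinite, the imaginary part of v₁ is 0, and the real part of v₁ satisfies Re(v₁) ≥ (V₁₁ + v̲·v̄)/(v̲ + v̄). -/
open Matrix
open scoped ComplexOrder

/-- Matrix core of the equivalence of nSDR and SDR: if `V ⪰ 0` is Hermitian with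
`v̲² ≤ V₁₁ ≤ v̄²` where `0 < v̲ < v̄`, then there is a vector `v` with `V ⪰ v vᴴ`,
`Im (v 0) = 0` and `Re (v 0) ≥ (V₁₁ + v̲ v̄)/(v̲ + v̄)`. -/
theorem exists_vector_nSDR {n : ℕ} (V : Matrix (Fin (n + 1)) (Fin (n + 1)) ℂ)
    (hV : V.PosSemidef) (vlb vub : ℝ) (hlb : 0 < vlb) (hlu : vlb < vub)
    (h1 : vlb ^ 2 ≤ (V 0 0).re) (h2 : (V 0 0).re ≤ vub ^ 2) :
    ∃ v : Fin (n + 1) → ℂ, (V - Matrix.vecMulVec v (star v)).PosSemidef ∧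
      (v 0).im = 0 ∧ (v 0).re ≥ ((V 0 0).re + vlb * vub) / (vlb + vub) := by
  have hd : 0 < (V 0 0).re := lt_of_lt_of_le (by positivity) h1
  set d := (V 0 0).re with hdd
  have hH : ∀ i j, star (V j i) = V i j := fun i j => hV.isHermitian.apply i j
  have h00 : V 0 0 = (d : ℂ) := by
    have h := hH 0 0
    exact (Complex.conj_eq_iff_re.mp h).symm
  have hdc : (d : ℂ) ≠ 0 := by exact_mod_cast hd.ne'
  set s := Real.sqrt d with hs
  have hs0 : 0 < s := Real.sqrt_pos.mpr hd
  have hss : s * s = d := Real.mul_self_sqrt hd.le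
  have hssc : (s : ℂ) * s = d := by exact_mod_cast hss
  have hsc : (s : ℂ) ≠ 0 := by exact_mod_cast hs0.ne'
  have hv0 : V 0 0 / (s : ℂ) = (s : ℂ) := by
    rw [h00, ← hssc]; field_simp
  refine ⟨fun i => V i 0 / (s : ℂ), ?_, ?_, ?_⟩
  · let r : Fin (n + 1) → ℂ := fun j => V 0 j / (d : ℂ)
    let B : Matrix (Fin (n + 1)) (Fin (n + 1)) ℂ := 1 - vecMulVec (Pi.single 0 1) r
    have hVB : V * B = V - vecMulVec (fun i => V i 0) r := by
      simp only [B, mul_sub, mul_one, mul_vecMulVec]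
      congr 2
      ext i
      simp
    have hrow : Pi.single 0 1 ᵥ* (V * B) = 0 := by
      ext j
      rw [hVB]
      simp [vecMulVec_apply, r, h00]
      field_simp
      simp
    have hB : Bᴴ * V * B = V * B := by
      rw [Matrix.mul_assoc]
      have : Bᴴ = 1 - vecMulVec (star r) (Pi.single 0 1) := by
        simp [B, conjTranspose_vecMulVec]
      rw [this, sub_mul, one_mul, vecMulVec_mul, hrow]
      simp
    have key : V - vecMulVec (fun i => V i 0 / (s : ℂ)) (star fun i => V i 0 / (s : ℂ))
        = Bᴴ * V * B := by
      rw [hB, hVB]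
      congr 1
      ext i j
      have hj := hH 0 j
      simp only [vecMulVec_apply, r, Pi.star_apply, star_div₀, hj]
      have : star (s : ℂ) = s := Complex.conj_ofReal s
      rw [this, ← hssc]
      field_simp
    rw [key]
    exact hV.conjTranspose_mul_mul_same B
  · simp only [hv0, Complex.ofReal_im]
  · simp only [hv0, Complex.ofReal_re]
    have ha : vlb ≤ s := Real.le_sqrt_of_sq_le h1
    have hb : s ≤ vub := Real.sqrt_le_iff.mpr ⟨by linarith, h2⟩
    rw [ge_iff_le, div_le_iff₀ (by linarith)]
    nlinarith [mul_nonneg (sub_nonneg.mpr ha) (sub_nonneg.mpr hb)]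
end

section
/- Let a, b be real numbers and c ∈ ℂ. The 2×2 Hermitian matrix [[a, c], [c̄, b]] is positive semidefinite if and only if the 3×3 Hermitian matrix [[a+b, 0, 2c], [0, a+b, a−b], [2c̄, a−b, a+b]] is positive semidefinite. -/
open Matrix
open scoped ComplexOrder

lemma aux_two (a b : ℝ) (c : ℂ) :
    (!![(a : ℂ), c; star c, (b : ℂ)]).PosSemidef ↔
      0 ≤ a ∧ 0 ≤ b ∧ c.re ^ 2 + c.im ^ 2 ≤ a * b := by
  constructor
  · intro h
    have h0 := h.diag_nonneg (i := 0)
    have h1 := h.diag_nonneg (i := 1)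
    have hd := h.det_nonneg
    simp [Matrix.det_fin_two, Complex.le_def] at h0 h1 hd
    refine ⟨h0, h1, ?_⟩
    nlinarith [hd.1]
  · rintro ⟨ha, hb, hc⟩
    refine .of_dotProduct_mulVec_nonneg ?_ fun x => ?_
    · ext i j
      fin_cases i <;> fin_cases j <;> simp
    · rw [Complex.le_def]
      simp [Matrix.mulVec, dotProduct, Fin.sum_univ_succ]
      generalize (x 0).re = p
      generalize (x 0).im = q
      generalize (x 1).re = r
      generalize (x 1).im = s
      generalize c.re = u at *
      generalize c.im = v at *
      refine ⟨?_, by ring⟩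
      rcases ha.eq_or_lt with rfl | ha
      · have hu : u = 0 := by nlinarith [sq_nonneg u, sq_nonneg v]
        have hv : v = 0 := by nlinarith [sq_nonneg u, sq_nonneg v]
        subst hu hv
        nlinarith [mul_nonneg hb (sq_nonneg r), mul_nonneg hb (sq_nonneg s)]
      · refine nonneg_of_mul_nonneg_right ?_ ha
        have h1 := mul_nonneg (sub_nonneg.2 hc) (add_nonneg (sq_nonneg r) (sq_nonneg s))
        linarith [sq_nonneg (a * p + (u * r - v * s)), sq_nonneg (a * q + (u * s + v * r))]

lemma aux_three (a b : ℝ) (c : ℂ) :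
      (!![(a : ℂ) + (b : ℂ), 0, 2 * c;
          0, (a : ℂ) + (b : ℂ), (a : ℂ) - (b : ℂ);
          2 * star c, (a : ℂ) - (b : ℂ), (a : ℂ) + (b : ℂ)]).PosSemidef ↔
      0 ≤ a + b ∧ c.re ^ 2 + c.im ^ 2 ≤ a * b := by
  constructor
  · intro h
    have h0 := h.diag_nonneg (i := 0)
    have hx (s : ℝ) := h.dotProduct_mulVec_nonneg ![-2 * c, -(a - b), s]
    simp [Complex.le_def, Matrix.mulVec, dotProduct, Fin.sum_univ_succ] at h0 hx
    refine ⟨h0, ?_⟩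
    rcases h0.eq_or_lt with h0 | h0
    · have h1 := (hx 1).1
      obtain rfl : b = -a := by linarith
      nlinarith
    · have h1 := (hx (a + b)).1
      have : 0 ≤ a * b - (c.re ^ 2 + c.im ^ 2) := by
        refine nonneg_of_mul_nonneg_right ?_ h0
        nlinarith
      linarith
  · rintro ⟨ht, hc⟩
    refine .of_dotProduct_mulVec_nonneg ?_ fun x => ?_
    · ext i j
      fin_cases i <;> fin_cases j <;> simp
    · rw [Complex.le_def]
      simp [Matrix.mulVec, dotProduct, Fin.sum_univ_succ]
      generalize (x 0).re = p
      generalize (x 0).im = q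
      generalize (x 1).re = r
      generalize (x 1).im = s
      generalize (x 2).re = y
      generalize (x 2).im = z
      generalize c.re = u at *
      generalize c.im = v at *
      refine ⟨?_, by ring⟩
      rcases ht.eq_or_lt with ht | ht
      · obtain rfl : b = -a := by linarith
        have hu : u = 0 := by nlinarith [sq_nonneg u, sq_nonneg v, sq_nonneg a]
        have hv : v = 0 := by nlinarith [sq_nonneg u, sq_nonneg v, sq_nonneg a]
        have hv : a = 0 := by nlinarith [sq_nonneg u, sq_nonneg v, sq_nonneg a]
        subst_vars
        simp
      · refine nonneg_of_mul_nonneg_right ?_ ht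
        have h1 := mul_nonneg (sub_nonneg.2 hc) (add_nonneg (sq_nonneg y) (sq_nonneg z))
        linarith [sq_nonneg ((a + b) * p + 2 * (u * y - v * z)),
          sq_nonneg ((a + b) * q + 2 * (u * z + v * y)),
          sq_nonneg ((a + b) * r + (a - b) * y), sq_nonneg ((a + b) * s + (a - b) * z)]

/-- The 2×2 Hermitian matrix `[[a, c], [c̄, b]]` (with `a, b` real) is positive
semidefinite iff the 3×3 Hermitian matrix
`[[a+b, 0, 2c], [0, a+b, a−b], [2c̄, a−b, a+b]]` is positive semidefinite. -/
theorem two_by_two_psd_iff_three_by_three_psd (a b : ℝ) (c : ℂ) :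
    (!![(a : ℂ), c; star c, (b : ℂ)]).PosSemidef ↔
      (!![(a : ℂ) + (b : ℂ), 0, 2 * c;
          0, (a : ℂ) + (b : ℂ), (a : ℂ) - (b : ℂ);
          2 * star c, (a : ℂ) - (b : ℂ), (a : ℂ) + (b : ℂ)]).PosSemidef := by
  rw [aux_two, aux_three]
  constructor
  · rintro ⟨ha, hb, hc⟩
    exact ⟨by linarith, hc⟩
  · rintro ⟨ht, hc⟩
    have hab : 0 ≤ a * b := by nlinarith [sq_nonneg c.re, sq_nonneg c.im]
    refine ⟨?_, ?_, hc⟩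
    · by_contra! h
      nlinarith
    · by_contra! h
      nlinarith
end
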